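/- For every win condition w ∈ [1/2,1), every positive integer k, and every finite simple graph S, there exist a finite simple graph G containing S as an induced subgraph and an initial configuration C_0 on G such that the w-power index process started from C_0 is eventually periodic with period at least k. -/

import Mathlib

open scoped Classical

/-- A strategy of a voter: collaborator (`C`) or defector (`D`). -/
inductive Strategy : Type
  | C : Strategy
  | D : Strategy
deriving DecidableEq

noncomputable section

variable {V : Type*}

/-- The closed neighbourhood `N[v]` of a vertex, as a finset. -/
def closedNbhd (G : SimpleGraph V) [Fintype V] (v : V) : Finset V :=
  Finset.univ.filter fun u => u = v ∨ G.Adj u v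

/-- The (Shapley–Shubik style) power of a vertex `v` in configuration `c`
with win condition `w`. -/
def power (G : SimpleGraph V) [Fintype V] (w : ℝ) (c : V → Strategy) (v : V) : ℝ :=
  let N := closedNbhd G v
  let nC := (N.filter fun u => c u = Strategy.C).card
  let nD := (N.filter fun u => c u = Strategy.D).card
  match c v with
  | Strategy.C => if w < (nC : ℝ) / (N.card : ℝ) then 1 / (nC : ℝ) else 0
  | Strategy.D => if (nC : ℝ) / (N.card : ℝ) ≤ w then 1 / (nD : ℝ) else 0

/-- One step of the `w`-power index process: every vertex adopts the strategy of a
vertex of maximum power in its closed neighbourhood, retaining its own strategy if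
vertices of maximum power have differing strategies. -/
def step (G : SimpleGraph V) [Fintype V] (w : ℝ) (c : V → Strategy) (v : V) : Strategy :=
  let N := closedNbhd G v
  let M := N.filter fun u => ∀ x ∈ N, power G w c x ≤ power G w c u
  if ∀ u ∈ M, c u = Strategy.C then Strategy.C
  else if ∀ u ∈ M, c u = Strategy.D then Strategy.D
  else c v

/-- `configSeq G w c0 i` is the configuration `C_i` of the `w`-power index process. -/
def configSeq (G : SimpleGraph V) [Fintype V] (w : ℝ) (c0 : V → Strategy) : ℕ → V → Strategy
  | 0 => c0
  | k + 1 => step G w (configSeq G w c0 k)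

/-- The process is eventually stable. -/
def EventuallyStable (G : SimpleGraph V) [Fintype V] (w : ℝ) (c0 : V → Strategy) : Prop :=
  ∃ i, configSeq G w c0 (i + 1) = configSeq G w c0 i

/-- The process reaches a stable all-collaborator configuration. -/
def CollaboratorDominant (G : SimpleGraph V) [Fintype V] (w : ℝ) (c0 : V → Strategy) : Prop :=
  ∃ i, configSeq G w c0 (i + 1) = configSeq G w c0 i ∧
    ∀ v, configSeq G w c0 i v = Strategy.C

/-- The process reaches a stable all-defector configuration. -/
def DefectorDominant (G : SimpleGraph V) [Fintype V] (w : ℝ) (c0 : V → Strategy) : Prop :=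
  ∃ i, configSeq G w c0 (i + 1) = configSeq G w c0 i ∧
    ∀ v, configSeq G w c0 i v = Strategy.D

/-- The process is eventually periodic with period `ℓ`: `ℓ > 1` is the least integer
such that `C_i = C_{i+ℓ}` for some `i ≥ 0`. -/
def EventuallyPeriodicWithPeriod (G : SimpleGraph V) [Fintype V] (w : ℝ)
    (c0 : V → Strategy) (ℓ : ℕ) : Prop :=
  IsLeast {m : ℕ | 1 < m ∧ ∃ i, configSeq G w c0 (i + m) = configSeq G w c0 i} ℓ

end

namespace PIP

section general
variable {V : Type*} [Fintype V] (G : SimpleGraph V) (w : ℝ) (c : V → Strategy)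

noncomputable def cnt (s : Strategy) (v : V) : ℕ := ((closedNbhd G v).filter fun u => c u = s).card

lemma mem_nbhd (u v : V) : u ∈ closedNbhd G v ↔ (u = v ∨ G.Adj u v) := by
  simp [closedNbhd]

lemma card_nbhd (v : V) : (closedNbhd G v).card = cnt G c .C v + cnt G c .D v := by
  unfold cnt
  rw [← Finset.card_union_of_disjoint]
  · congr 1
    ext u
    simp only [Finset.mem_union, Finset.mem_filter]
    cases h : c u <;> simp
  · rw [Finset.disjoint_filter]
    intro u _ h1 h2
    simp [h1] at h2

lemma card_pos (v : V) : 0 < cnt G c .C v + cnt G c .D v := by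
  rw [← card_nbhd]
  exact Finset.card_pos.mpr ⟨v, by simp [mem_nbhd]⟩

lemma power_C_pos {v : V} (h : c v = .C)
    (hw : w * ((cnt G c .C v : ℝ) + cnt G c .D v) < cnt G c .C v) :
    power G w c v = 1 / (cnt G c .C v : ℝ) := by
  have hp : (0 : ℝ) < (cnt G c .C v : ℝ) + cnt G c .D v := by exact_mod_cast card_pos G c v
  unfold power
  simp only [h]
  rw [if_pos]
  · rfl
  · rw [card_nbhd G c, Nat.cast_add, lt_div_iff₀ hp]
    exact hw

lemma power_C_zero {v : V} (h : c v = .C)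
    (hw : (cnt G c .C v : ℝ) ≤ w * ((cnt G c .C v : ℝ) + cnt G c .D v)) :
    power G w c v = 0 := by
  have hp : (0 : ℝ) < (cnt G c .C v : ℝ) + cnt G c .D v := by exact_mod_cast card_pos G c v
  unfold power
  simp only [h]
  rw [if_neg]
  rw [card_nbhd G c, Nat.cast_add, lt_div_iff₀ hp, not_lt]
  exact hw

lemma power_D_pos {v : V} (h : c v = .D)
    (hw : (cnt G c .C v : ℝ) ≤ w * ((cnt G c .C v : ℝ) + cnt G c .D v)) :
    power G w c v = 1 / (cnt G c .D v : ℝ) := by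
  have hp : (0 : ℝ) < (cnt G c .C v : ℝ) + cnt G c .D v := by exact_mod_cast card_pos G c v
  unfold power
  simp only [h]
  rw [if_pos]
  · rfl
  · rw [card_nbhd G c, Nat.cast_add, div_le_iff₀ hp]
    exact hw

lemma power_D_zero {v : V} (h : c v = .D)
    (hw : w * ((cnt G c .C v : ℝ) + cnt G c .D v) < cnt G c .C v) :
    power G w c v = 0 := by
  have hp : (0 : ℝ) < (cnt G c .C v : ℝ) + cnt G c .D v := by exact_mod_cast card_pos G c v
  unfold power
  simp only [h]
  rw [if_neg]
  rw [card_nbhd G c, Nat.cast_add, div_le_iff₀ hp, not_le]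
  exact hw

/-- A strictly dominating neighbour fixes the new strategy. -/
lemma step_strict {v u : V} {s : Strategy} (hu : u = v ∨ G.Adj u v) (hs : c u = s)
    (h : ∀ x, (x = v ∨ G.Adj x v) → c x ≠ s → power G w c x < power G w c u) :
    step G w c v = s := by
  have hM : ∀ x ∈ (closedNbhd G v).filter
      (fun u => ∀ x ∈ closedNbhd G v, power G w c x ≤ power G w c u), c x = s := by
    intro x hx
    rw [Finset.mem_filter] at hx
    by_contra hne
    have h1 := h x ((mem_nbhd G x v).1 hx.1) hne
    have h2 := hx.2 u ((mem_nbhd G u v).2 hu)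
    linarith
  obtain ⟨y, hy, hmax⟩ := Finset.exists_max_image (closedNbhd G v) (power G w c)
    ⟨v, by simp [mem_nbhd]⟩
  have hyM : y ∈ (closedNbhd G v).filter
      (fun u => ∀ x ∈ closedNbhd G v, power G w c x ≤ power G w c u) :=
    Finset.mem_filter.2 ⟨hy, hmax⟩
  unfold step
  simp only
  cases s with
  | C => rw [if_pos hM]
  | D =>
    rw [if_neg, if_pos hM]
    intro hc
    have := hc y hyM
    rw [hM y hyM] at this
    cases this

/-- A weakly dominating neighbour with the same strategy preserves the strategy. -/
lemma step_weak {v u : V} {s : Strategy} (hv : c v = s) (hu : u = v ∨ G.Adj u v) (hs : c u = s)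
    (h : ∀ x, (x = v ∨ G.Adj x v) → c x ≠ s → power G w c x ≤ power G w c u) :
    step G w c v = s := by
  obtain ⟨y, hy, hmax⟩ := Finset.exists_max_image (closedNbhd G v) (power G w c)
    ⟨v, by simp [mem_nbhd]⟩
  have hyM : ∃ y ∈ (closedNbhd G v).filter
      (fun u => ∀ x ∈ closedNbhd G v, power G w c x ≤ power G w c u), c y = s := by
    by_cases hys : c y = s
    · exact ⟨y, Finset.mem_filter.2 ⟨hy, hmax⟩, hys⟩
    · refine ⟨u, Finset.mem_filter.2 ⟨(mem_nbhd G u v).2 hu, ?_⟩, hs⟩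
      intro x hx
      exact (hmax x hx).trans (h y ((mem_nbhd G y v).1 hy) hys)
  obtain ⟨z, hz, hzs⟩ := hyM
  unfold step
  simp only
  split_ifs with h1 h2
  · rw [← hzs, h1 z hz]
  · rw [← hzs, h2 z hz]
  · exact hv

end general

section transport
variable {V W : Type*} [Fintype V] [Fintype W] (G : SimpleGraph V) (H : SimpleGraph W)
  (e : G ≃g H) (w : ℝ)

lemma cnt_iso (c : W → Strategy) (s : Strategy) (v : V) :
    cnt G (c ∘ e) s v = cnt H c s (e v) := by
  unfold cnt
  refine Finset.card_bij (fun a _ => e a) ?_ ?_ ?_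
  · intro a ha
    simpa [mem_nbhd, e.map_adj_iff] using ha
  · intro a _ b _ h
    exact e.injective h
  · intro b hb
    refine ⟨e.symm b, ?_, by simp⟩
    rw [Finset.mem_filter, mem_nbhd] at hb ⊢
    have : H.Adj b (e v) ↔ G.Adj (e.symm b) v := by
      rw [← e.map_adj_iff]; simp
    rw [this] at hb
    refine ⟨hb.1.imp (fun h => by simp [h]) id, by simpa using hb.2⟩

lemma power_iso (c : W → Strategy) (v : V) :
    power G w (c ∘ e) v = power H w c (e v) := by
  have hC := cnt_iso G H e c .C v
  have hD := cnt_iso G H e c .D v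
  have hN := card_nbhd G (c ∘ e) v
  rw [hC, hD, ← card_nbhd] at hN
  unfold cnt at hC hD
  simp only [Function.comp_apply] at hC hD
  unfold power
  simp only [hC, hD, hN, Function.comp_apply]

lemma step_iso (c : W → Strategy) : step G w (c ∘ e) = step H w c ∘ e := by
  funext v
  have hM : ∀ s : Strategy, (∀ u ∈ (closedNbhd G v).filter
      (fun u => ∀ x ∈ closedNbhd G v, power G w (c ∘ e) x ≤ power G w (c ∘ e) u), (c ∘ e) u = s) ↔
      (∀ u ∈ (closedNbhd H (e v)).filter
      (fun u => ∀ x ∈ closedNbhd H (e v), power H w c x ≤ power H w c u), c u = s) := by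
    intro s
    simp only [Finset.mem_filter, mem_nbhd, power_iso G H e w, Function.comp_apply]
    rw [e.surjective.forall]
    refine forall_congr' fun u => ?_
    rw [e.surjective.forall]
    simp only [e.map_adj_iff, e.injective.eq_iff]
  unfold step
  simp only [Function.comp_apply]
  simp only [Function.comp_apply] at hM
  rw [if_congr (hM .C) rfl (if_congr (hM .D) rfl rfl)]

lemma configSeq_iso (c : W → Strategy) (i : ℕ) :
    configSeq G w (c ∘ e) i = configSeq H w c i ∘ e := by
  induction i with
  | zero => rfl
  | succ i ih => 
    show step G w (configSeq G w (c ∘ e) i) = step H w (configSeq H w c i) ∘ e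
    rw [ih, step_iso]

end transport

inductive Vt (U : Type) (n : ℕ) : Type
  | u : U → Vt U n
  | y : ZMod n → Vt U n
  | x : Bool → ZMod n → Vt U n
  | q : Fin n → Vt U n
  | r : Fin (2 * n) → Vt U n
  | k : Vt U n
  | l : Fin 5 → Vt U n

variable {U : Type} {n : ℕ}

def eqv (U : Type) (n : ℕ) :
    (U ⊕ ZMod n ⊕ ZMod n ⊕ ZMod n ⊕ Fin n ⊕ Fin (2 * n) ⊕ Unit ⊕ Fin 5) ≃ Vt U n where
  toFun
    | .inl a => .u a
    | .inr (.inl i) => .y i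
    | .inr (.inr (.inl i)) => .x true i
    | .inr (.inr (.inr (.inl i))) => .x false i
    | .inr (.inr (.inr (.inr (.inl i)))) => .q i
    | .inr (.inr (.inr (.inr (.inr (.inl i))))) => .r i
    | .inr (.inr (.inr (.inr (.inr (.inr (.inl _)))))) => .k
    | .inr (.inr (.inr (.inr (.inr (.inr (.inr i)))))) => .l i
  invFun
    | .u a => .inl a
    | .y i => .inr (.inl i)
    | .x true i => .inr (.inr (.inl i))
    | .x false i => .inr (.inr (.inr (.inl i)))
    | .q i => .inr (.inr (.inr (.inr (.inl i))))
    | .r i => .inr (.inr (.inr (.inr (.inr (.inl i)))))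
    | .k => .inr (.inr (.inr (.inr (.inr (.inr (.inl ()))))))
    | .l i => .inr (.inr (.inr (.inr (.inr (.inr (.inr i))))))
  left_inv := by
    rintro (a | i | i | i | i | i | i | i) <;> rfl
  right_inv := by
    rintro (a | i | ⟨_ | _, i⟩ | i | i | _ | i) <;> rfl

noncomputable instance [Fintype U] [NeZero n] : Fintype (Vt U n) := Fintype.ofEquiv _ (eqv U n)

lemma card_split [Fintype U] [NeZero n] (P : Vt U n → Prop) [DecidablePred P] :
    (Finset.univ.filter P).card =
      (Finset.univ.filter fun a => P (.u a)).card +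
      ((Finset.univ.filter fun a => P (.y a)).card +
      ((Finset.univ.filter fun a => P (.x true a)).card +
      ((Finset.univ.filter fun a => P (.x false a)).card +
      ((Finset.univ.filter fun a => P (.q a)).card +
      ((Finset.univ.filter fun a => P (.r a)).card +
      ((if P .k then 1 else 0) +
      (Finset.univ.filter fun a => P (.l a)).card)))))) := by
  simp only [Finset.card_filter]
  rw [← (eqv U n).sum_comp]
  simp only [Fintype.sum_sum_type, eqv, Equiv.coe_fn_mk, Finset.univ_unique, Finset.sum_singleton]
  congr!

def adj (S : SimpleGraph U) : Vt U n → Vt U n → Prop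
  | .u a, .u b => S.Adj a b
  | .y i, .y j => i ≠ j ∧ (i = j + 1 ∨ j = i + 1)
  | .y i, .x _ j => i = j
  | .x _ j, .y i => i = j
  | .x _ _, .r _ => True
  | .r _, .x _ _ => True
  | .y _, .q _ => True
  | .q _, .y _ => True
  | .y _, .k => True
  | .k, .y _ => True
  | .k, .l _ => True
  | .l _, .k => True
  | _, _ => False

def gr (S : SimpleGraph U) (n : ℕ) : SimpleGraph (Vt U n) where
  Adj := adj S
  symm := ⟨by
    rintro (a | i | ⟨b, i⟩ | i | i | _ | i) (a' | i' | ⟨b', i'⟩ | i' | i' | _ | i') h <;>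
      simp only [adj] at h ⊢
    · exact h.symm
    · exact ⟨h.1.symm, h.2.symm⟩
    · exact h
    · exact h⟩
  loopless := ⟨by
    rintro (a | i | ⟨b, i⟩ | i | i | _ | i) h <;> simp [adj] at h⟩

noncomputable def cfg (U : Type) (n : ℕ) (g : ZMod n) : Vt U n → Strategy
  | .u _ => .D
  | .y j => if j = g ∨ j = g + 1 ∨ j = g + 2 then .C else .D
  | .x _ j => if j + 1 = g ∨ j = g ∨ j = g + 1 then .C else .D
  | .q _ => .C
  | .r _ => .D
  | .k => .D
  | .l _ => .D

lemma cnt_split [Fintype U] [NeZero n] (S : SimpleGraph U) (c : Vt U n → Strategy) (s : Strategy)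
    (v : Vt U n) :
    cnt (gr S n) c s v =
      (Finset.univ.filter fun a => (Vt.u a = v ∨ adj S (.u a) v) ∧ c (.u a) = s).card +
      ((Finset.univ.filter fun a => (Vt.y a = v ∨ adj S (.y a) v) ∧ c (.y a) = s).card +
      ((Finset.univ.filter fun a => (Vt.x true a = v ∨ adj S (.x true a) v) ∧ c (.x true a) = s).card +
      ((Finset.univ.filter fun a => (Vt.x false a = v ∨ adj S (.x false a) v) ∧ c (.x false a) = s).card +
      ((Finset.univ.filter fun a => (Vt.q a = v ∨ adj S (.q a) v) ∧ c (.q a) = s).card +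
      ((Finset.univ.filter fun a => (Vt.r a = v ∨ adj S (.r a) v) ∧ c (.r a) = s).card +
      ((if (Vt.k = v ∨ adj S .k v) ∧ c .k = s then 1 else 0) +
      (Finset.univ.filter fun a => (Vt.l a = v ∨ adj S (.l a) v) ∧ c (.l a) = s).card)))))) := by
  unfold cnt closedNbhd
  rw [Finset.filter_filter]
  convert card_split (fun u => (u = v ∨ adj S u v) ∧ c u = s) using 1
  congr!

lemma ite_C {p : Prop} [Decidable p] : (if p then Strategy.C else Strategy.D) = .C ↔ p := by
  split_ifs <;> simp_all

lemma ite_D {p : Prop} [Decidable p] : (if p then Strategy.C else Strategy.D) = .D ↔ ¬ p := by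
  split_ifs <;> simp_all

lemma two_mem {P : ZMod n → Prop} [DecidablePred P] (a b : ZMod n) (hab : a ≠ b) 
    (h : ∀ x, P x ↔ x = a ∨ x = b) [NeZero n] : (Finset.univ.filter P).card = 2 := by
  have : Finset.univ.filter P = {a, b} := by ext x; simp [h]
  rw [this, Finset.card_pair hab]

lemma three_mem {P : ZMod n → Prop} [DecidablePred P] (a b c : ZMod n) (hab : a ≠ b) (hac : a ≠ c) (hbc : b ≠ c)
    (h : ∀ x, P x ↔ x = a ∨ x = b ∨ x = c) [NeZero n] : (Finset.univ.filter P).card = 3 := by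
  have : Finset.univ.filter P = {a, b, c} := by ext x; simp [h]
  rw [this, Finset.card_eq_three]
  exact ⟨a, b, c, hab, hac, hbc, rfl⟩

variable [Fintype U] [NeZero n] (S : SimpleGraph U) (g : ZMod n)

lemma cast_ne (hn : 11 ≤ n) (m : ℕ) (h0 : 0 < m) (hm : m < 11) : (m : ZMod n) ≠ 0 := by
  rw [Ne, ZMod.natCast_eq_zero_iff]
  intro h
  have := Nat.le_of_dvd h0 h
  omega


lemma zero_mem {α : Type*} [Fintype α] {P : α → Prop} [DecidablePred P] (h : ∀ x, ¬ P x) :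
    (Finset.univ.filter P).card = 0 := by
  rw [Finset.card_eq_zero, Finset.filter_eq_empty_iff]
  intro x _
  exact h x

lemma all_mem {α : Type*} [Fintype α] {P : α → Prop} [DecidablePred P] (h : ∀ x, P x) :
    (Finset.univ.filter P).card = Fintype.card α := by
  rw [Finset.filter_true_of_mem (fun x _ => h x), Finset.card_univ]

lemma one_mem {α : Type*} [Fintype α] {P : α → Prop} [DecidablePred P] (a : α)
    (h : ∀ x, P x ↔ x = a) :
    (Finset.univ.filter P).card = 1 := by
  have : Finset.univ.filter P = {a} := by ext x; simp [h]
  rw [this, Finset.card_singleton]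

lemma le_one_mem {α : Type*} [Fintype α] {P : α → Prop} [DecidablePred P] (a : α)
    (h : ∀ x, P x → x = a) :
    (Finset.univ.filter P).card ≤ 1 := by
  have : Finset.univ.filter P ⊆ {a} := by intro x; simpa using h x
  simpa using Finset.card_le_card this

lemma not_three_mem {P : ZMod n → Prop} [DecidablePred P] (a b c : ZMod n)
    (hab : a ≠ b) (hac : a ≠ c) (hbc : b ≠ c)
    (h : ∀ x, P x ↔ ¬ (x = a ∨ x = b ∨ x = c)) : (Finset.univ.filter P).card + 3 = n := by
  have h3 := three_mem (P := fun x => (x = a ∨ x = b ∨ x = c)) a b c hab hac hbc (fun x => Iff.rfl)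
  have := Finset.card_filter_add_card_filter_not (s := (Finset.univ : Finset (ZMod n)))
    (fun x => (x = a ∨ x = b ∨ x = c))
  rw [h3, Finset.card_univ, ZMod.card] at this
  have h4 : Finset.univ.filter P = Finset.univ.filter (fun x => ¬ (x = a ∨ x = b ∨ x = c)) := by
    ext x; simp only [Finset.mem_filter, h]
  rw [h4]
  convert (show _ + 3 = n by rw [add_comm]; exact this)

structure NZ (n : ℕ) : Prop where
  h1 : (1 : ZMod n) ≠ 0
  h2 : (2 : ZMod n) ≠ 0
  h3 : (3 : ZMod n) ≠ 0
  h4 : (4 : ZMod n) ≠ 0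

lemma nz_of (hn : 11 ≤ n) : NZ n :=
  ⟨by simpa using cast_ne hn 1 (by omega) (by omega), by simpa using cast_ne hn 2 (by omega) (by omega),
  by simpa using cast_ne hn 3 (by omega) (by omega), by simpa using cast_ne hn 4 (by omega) (by omega)⟩

lemma nzf (hn : NZ n) (a : ZMod n) : a ≠ a + 1 ∧ a ≠ a + 2 ∧ a + 1 ≠ a + 2 ∧ a - 1 ≠ a ∧
    a - 1 ≠ a + 1 ∧ a + 2 + 1 ≠ a ∧ a - 1 ≠ a + 2 ∧ a + 3 ≠ a ∧ (1 : ZMod n) ≠ 2 ∧ a + 1 + 1 ≠ a ∧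
    (1 : ZMod n) ≠ 0 ∧ (2 : ZMod n) ≠ 0 ∧ (2 : ZMod n) ≠ 1 := by
  obtain ⟨h1, h2, h3, h4⟩ := hn
  refine ⟨fun h => h1 ?_, fun h => h2 ?_, fun h => h1 ?_, fun h => h1 ?_, fun h => h2 ?_,
    fun h => h3 ?_, fun h => h3 ?_, fun h => h3 ?_, fun h => h1 ?_, fun h => h2 ?_, h1, h2,
    fun h => h1 ?_⟩
  · linear_combination -h
  · linear_combination -h
  · linear_combination -h
  · linear_combination -h
  · linear_combination -h
  · linear_combination h
  · linear_combination -h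
  · linear_combination h
  · linear_combination -h
  · linear_combination h
  · linear_combination h

lemma tot_y (hn : NZ n) (i : ZMod n) :
    cnt (gr S n) (cfg U n g) .C (.y i) + cnt (gr S n) (cfg U n g) .D (.y i) = n + 6 := by
  obtain ⟨h1, h2, h3, h4, h5, h6, h7, h8, h9, h10, h11, h12, h13⟩ := nzf hn i
  rw [← card_nbhd]
  unfold closedNbhd
  rw [card_split, zero_mem, three_mem (i - 1) i (i + 1), one_mem i, one_mem i, all_mem, zero_mem,
    zero_mem, if_pos]
  · simp; omega
  all_goals simp [gr, adj]
  all_goals grind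

lemma C_y_ge (i : ZMod n) : n ≤ cnt (gr S n) (cfg U n g) .C (.y i) := by
  rw [cnt_split, all_mem (P := fun a => ((Vt.q a : Vt U n) = .y i ∨ adj S (.q a) (.y i)) ∧ cfg U n g (.q a) = .C)]
  · rw [Fintype.card_fin]; omega
  · simp [adj, cfg]

lemma C_y0 (hn : NZ n) : cnt (gr S n) (cfg U n g) .C (.y g) = n + 4 := by
  obtain ⟨h1, h2, h3, h4, h5, h6, h7, h8, h9, h10, h11, h12, h13⟩ := nzf hn g
  rw [cnt_split, zero_mem, two_mem g (g + 1), one_mem g, one_mem g, all_mem, zero_mem,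
    zero_mem, if_neg]
  · simp; omega
  all_goals simp [adj, cfg, ite_C, ite_D]
  all_goals grind

lemma C_y1 (hn : NZ n) : cnt (gr S n) (cfg U n g) .C (.y (g + 1)) = n + 5 := by
  obtain ⟨h1, h2, h3, h4, h5, h6, h7, h8, h9, h10, h11, h12, h13⟩ := nzf hn g
  rw [cnt_split, zero_mem, three_mem g (g + 1) (g + 2), one_mem (g + 1), one_mem (g + 1), all_mem,
    zero_mem, zero_mem, if_neg]
  · simp; omega
  all_goals simp [adj, cfg, ite_C, ite_D]
  all_goals grind

lemma C_y2 (hn : NZ n) : cnt (gr S n) (cfg U n g) .C (.y (g + 2)) = n + 2 := by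
  obtain ⟨h1, h2, h3, h4, h5, h6, h7, h8, h9, h10, h11, h12, h13⟩ := nzf hn g
  rw [cnt_split, zero_mem, two_mem (g + 1) (g + 2), zero_mem, zero_mem, all_mem,
    zero_mem, zero_mem, if_neg]
  · simp; omega
  all_goals simp [adj, cfg, ite_C, ite_D]
  all_goals grind

lemma C_x (b : Bool) (i : ZMod n) : cnt (gr S n) (cfg U n g) .C (.x b i) ≤ 2 := by
  rw [cnt_split]
  have hy := le_one_mem (P := fun a => ((Vt.y a : Vt U n) = Vt.x b i ∨ adj S (Vt.y a) (.x b i)) ∧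
    cfg U n g (.y a) = .C) i (by simp +contextual [adj])
  have hx := le_one_mem (P := fun a => ((Vt.x b a : Vt U n) = Vt.x b i ∨ adj S (Vt.x b a) (.x b i)) ∧
    cfg U n g (.x b a) = .C) i (by simp +contextual [adj])
  have hx' := zero_mem (P := fun a => ((Vt.x (!b) a : Vt U n) = Vt.x b i ∨ adj S (Vt.x (!b) a) (.x b i)) ∧
    cfg U n g (.x (!b) a) = .C) (by simp [adj])
  have hu := zero_mem (P := fun a => ((Vt.u a : Vt U n) = Vt.x b i ∨ adj S (Vt.u a) (.x b i)) ∧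
    cfg U n g (.u a) = .C) (by simp [adj])
  have hq := zero_mem (P := fun a => ((Vt.q a : Vt U n) = Vt.x b i ∨ adj S (Vt.q a) (.x b i)) ∧
    cfg U n g (.q a) = .C) (by simp [adj])
  have hr := zero_mem (P := fun a => ((Vt.r a : Vt U n) = Vt.x b i ∨ adj S (Vt.r a) (.x b i)) ∧
    cfg U n g (.r a) = .C) (by simp [cfg])
  have hl := zero_mem (P := fun a => ((Vt.l a : Vt U n) = Vt.x b i ∨ adj S (Vt.l a) (.x b i)) ∧
    cfg U n g (.l a) = .C) (by simp [cfg])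
  rw [hu, hq, hr, hl, if_neg (by simp [cfg])]
  cases b <;> simp only [Bool.not_true, Bool.not_false] at hx' <;> omega

lemma D_x (b : Bool) (i : ZMod n) : 2 * n ≤ cnt (gr S n) (cfg U n g) .D (.x b i) := by
  rw [cnt_split, all_mem (P := fun a => ((Vt.r a : Vt U n) = .x b i ∨ adj S (.r a) (.x b i)) ∧ cfg U n g (.r a) = .D)]
  · rw [Fintype.card_fin]; omega
  · simp [adj, cfg]

lemma C_r (hn : NZ n) (i) : cnt (gr S n) (cfg U n g) .C (.r i) = 6 := by
  obtain ⟨h1, h2, h3, h4, h5, h6, h7, h8, h9, h10, h11, h12, h13⟩ := nzf hn g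
  rw [cnt_split, zero_mem, zero_mem, three_mem (g - 1) g (g + 1), three_mem (g - 1) g (g + 1),
    zero_mem, zero_mem, zero_mem, if_neg]
  all_goals simp [adj, cfg, ite_C, ite_D]
  all_goals grind

lemma D_r (hn : NZ n) (i) : cnt (gr S n) (cfg U n g) .D (.r i) + 5 = 2 * n := by
  obtain ⟨h1, h2, h3, h4, h5, h6, h7, h8, h9, h10, h11, h12, h13⟩ := nzf hn g
  have hx := fun b => not_three_mem (P := fun a => ((Vt.x b a : Vt U n) = Vt.r i ∨ adj S (Vt.x b a) (.r i)) ∧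
    cfg U n g (.x b a) = .D) (g - 1) g (g + 1) (by assumption) (by assumption) (by assumption)
    (by simp [adj, cfg, ite_D]; grind)
  have := hx true
  have := hx false
  rw [cnt_split, zero_mem, zero_mem, zero_mem (α := Fin n), one_mem (α := Fin (2 * n)) i,
    zero_mem (α := Fin 5), if_neg]
  · omega
  all_goals simp [adj, cfg, ite_C, ite_D]

lemma C_q (hn : NZ n) (i) : cnt (gr S n) (cfg U n g) .C (.q i) = 4 := by
  obtain ⟨h1, h2, h3, h4, h5, h6, h7, h8, h9, h10, h11, h12, h13⟩ := nzf hn g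
  rw [cnt_split, zero_mem, three_mem g (g + 1) (g + 2), zero_mem, zero_mem,
    one_mem i, zero_mem, zero_mem, if_neg]
  all_goals simp [adj, cfg, ite_C, ite_D]
  all_goals grind

lemma D_q (hn : NZ n) (i) : cnt (gr S n) (cfg U n g) .D (.q i) + 3 = n := by
  obtain ⟨h1, h2, h3, h4, h5, h6, h7, h8, h9, h10, h11, h12, h13⟩ := nzf hn g
  have := not_three_mem (P := fun a => ((Vt.y a : Vt U n) = Vt.q i ∨ adj S (Vt.y a) (.q i)) ∧
    cfg U n g (.y a) = .D) g (g + 1) (g + 2) (by assumption) (by assumption) (by assumption)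
    (by simp [adj, cfg, ite_D])
  rw [cnt_split, zero_mem (α := U), zero_mem (P := fun a => ((Vt.x true a : Vt U n) = _ ∨ _) ∧ _),
    zero_mem (P := fun a => ((Vt.x false a : Vt U n) = _ ∨ _) ∧ _), zero_mem (α := Fin n),
    zero_mem (α := Fin (2 * n)), zero_mem (α := Fin 5), if_neg]
  · omega
  all_goals simp [adj, cfg, ite_C, ite_D]

lemma C_k (hn : NZ n) : cnt (gr S n) (cfg U n g) .C .k = 3 := by
  obtain ⟨h1, h2, h3, h4, h5, h6, h7, h8, h9, h10, h11, h12, h13⟩ := nzf hn g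
  rw [cnt_split, zero_mem, three_mem g (g + 1) (g + 2), zero_mem, zero_mem,
    zero_mem, zero_mem, zero_mem, if_neg]
  all_goals simp [adj, cfg, ite_C, ite_D]
  all_goals grind

lemma D_k (hn : NZ n) : cnt (gr S n) (cfg U n g) .D .k = n + 3 := by
  obtain ⟨h1, h2, h3, h4, h5, h6, h7, h8, h9, h10, h11, h12, h13⟩ := nzf hn g
  have := not_three_mem (P := fun a => ((Vt.y a : Vt U n) = Vt.k ∨ adj S (Vt.y a) .k) ∧
    cfg U n g (.y a) = .D) g (g + 1) (g + 2) (by assumption) (by assumption) (by assumption)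
    (by simp [adj, cfg, ite_D])
  rw [cnt_split, zero_mem (α := U), zero_mem (P := fun a => ((Vt.x true a : Vt U n) = _ ∨ _) ∧ _),
    zero_mem (P := fun a => ((Vt.x false a : Vt U n) = _ ∨ _) ∧ _), zero_mem (α := Fin n),
    zero_mem (α := Fin (2 * n)), all_mem (α := Fin 5), if_pos]
  · rw [Fintype.card_fin]; omega
  all_goals simp [adj, cfg, ite_C, ite_D]

lemma C_l (i) : cnt (gr S n) (cfg U n g) .C (.l i) = 0 := by
  rw [cnt_split, zero_mem, zero_mem, zero_mem, zero_mem, zero_mem, zero_mem, zero_mem, if_neg]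
  all_goals simp [adj, cfg, ite_C, ite_D]

lemma D_l (i) : cnt (gr S n) (cfg U n g) .D (.l i) = 2 := by
  rw [cnt_split, zero_mem, zero_mem, zero_mem, zero_mem, zero_mem, zero_mem, one_mem i, if_pos]
  all_goals simp [adj, cfg, ite_C, ite_D]


structure Big (n : ℕ) (w : ℝ) : Prop where
  hn : 11 ≤ n
  hw1 : 1 / 2 ≤ w
  hw2 : w < 1
  hw : w * (n + 6) < n

lemma Big.cast {w : ℝ} (hB : Big n w) : (11 : ℝ) ≤ n := by exact_mod_cast hB.hn

lemma Big.nz {w : ℝ} (hB : Big n w) : NZ n := nz_of hB.hn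

lemma win_y {w : ℝ} (hB : Big n w) (i : ZMod n) :
    w * ((cnt (gr S n) (cfg U n g) .C (.y i) : ℝ) + cnt (gr S n) (cfg U n g) .D (.y i))
      < cnt (gr S n) (cfg U n g) .C (.y i) := by
  have h1 := tot_y S g hB.nz i
  have h2 := C_y_ge S g i
  have h1' : (cnt (gr S n) (cfg U n g) .C (.y i) : ℝ) + cnt (gr S n) (cfg U n g) .D (.y i) = n + 6 := by
    exact_mod_cast h1
  have h2' : (n : ℝ) ≤ cnt (gr S n) (cfg U n g) .C (.y i) := by exact_mod_cast h2
  rw [h1']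
  linarith [hB.hw]

lemma p_y0 {w : ℝ} (hB : Big n w) : power (gr S n) w (cfg U n g) (.y g) = 1 / (n + 4) := by
  rw [power_C_pos _ _ _ (by simp [cfg]) (win_y S g hB _), C_y0 S g hB.nz]
  push_cast; rfl

lemma p_y1 {w : ℝ} (hB : Big n w) : power (gr S n) w (cfg U n g) (.y (g + 1)) = 1 / (n + 5) := by
  rw [power_C_pos _ _ _ (by simp [cfg]) (win_y S g hB _), C_y1 S g hB.nz]
  push_cast; rfl

lemma p_y2 {w : ℝ} (hB : Big n w) : power (gr S n) w (cfg U n g) (.y (g + 2)) = 1 / (n + 2) := by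
  rw [power_C_pos _ _ _ (by simp [cfg]) (win_y S g hB _), C_y2 S g hB.nz]
  push_cast; rfl

lemma p_yD {w : ℝ} (hB : Big n w) (i : ZMod n) (h : cfg U n g (.y i) = .D) :
    power (gr S n) w (cfg U n g) (.y i) = 0 :=
  power_D_zero _ _ _ h (win_y S g hB _)

lemma lose_x {w : ℝ} (hB : Big n w) (b : Bool) (i : ZMod n) :
    (cnt (gr S n) (cfg U n g) .C (.x b i) : ℝ) ≤
    w * ((cnt (gr S n) (cfg U n g) .C (.x b i) : ℝ) + cnt (gr S n) (cfg U n g) .D (.x b i)) := by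
  have h1 : (cnt (gr S n) (cfg U n g) .C (.x b i) : ℝ) ≤ 2 := by exact_mod_cast C_x S g b i
  have h2 : (2 : ℝ) * n ≤ cnt (gr S n) (cfg U n g) .D (.x b i) := by exact_mod_cast D_x S g b i
  have h3 := hB.cast
  have h4 := hB.hw1
  have h5 : (0 : ℝ) ≤ (cnt (gr S n) (cfg U n g) .C (.x b i) : ℝ) := by positivity
  nlinarith

lemma p_xC {w : ℝ} (hB : Big n w) (b : Bool) (i : ZMod n) (h : cfg U n g (.x b i) = .C) :
    power (gr S n) w (cfg U n g) (.x b i) = 0 :=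
  power_C_zero _ _ _ h (lose_x S g hB b i)

lemma p_xD {w : ℝ} (hB : Big n w) (b : Bool) (i : ZMod n) (h : cfg U n g (.x b i) = .D) :
    power (gr S n) w (cfg U n g) (.x b i) ≤ 1 / (2 * n) := by
  rw [power_D_pos _ _ _ h (lose_x S g hB b i)]
  have h2 : (2 : ℝ) * n ≤ cnt (gr S n) (cfg U n g) .D (.x b i) := by exact_mod_cast D_x S g b i
  have h3 := hB.cast
  exact one_div_le_one_div_of_le (by linarith) h2

lemma p_r {w : ℝ} (hB : Big n w) (i) :
    power (gr S n) w (cfg U n g) (.r i) = 1 / (2 * n - 5) := by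
  have h1 : (cnt (gr S n) (cfg U n g) .C (.r i) : ℝ) = 6 := by exact_mod_cast C_r S g hB.nz i
  have h2 : (cnt (gr S n) (cfg U n g) .D (.r i) : ℝ) + 5 = 2 * n := by
    exact_mod_cast D_r S g hB.nz i
  have h3 := hB.cast
  have h4 := hB.hw1
  rw [power_D_pos _ _ _ (by simp [cfg])]
  · rw [← h2]; congr 1; ring
  · nlinarith

lemma p_q {w : ℝ} (hB : Big n w) (i) :
    power (gr S n) w (cfg U n g) (.q i) = 0 := by
  have h1 : (cnt (gr S n) (cfg U n g) .C (.q i) : ℝ) = 4 := by exact_mod_cast C_q S g hB.nz i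
  have h2 : (cnt (gr S n) (cfg U n g) .D (.q i) : ℝ) + 3 = n := by
    exact_mod_cast D_q S g hB.nz i
  have h3 := hB.cast
  have h4 := hB.hw1
  rw [power_C_zero _ _ _ (by simp [cfg])]
  nlinarith

lemma p_k {w : ℝ} (hB : Big n w) :
    power (gr S n) w (cfg U n g) .k = 1 / (n + 3) := by
  have h1 : (cnt (gr S n) (cfg U n g) .C .k : ℝ) = 3 := by exact_mod_cast C_k S g hB.nz
  have h2 : (cnt (gr S n) (cfg U n g) .D .k : ℝ) = n + 3 := by
    exact_mod_cast D_k S g hB.nz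
  have h3 := hB.cast
  have h4 := hB.hw1
  rw [power_D_pos _ _ _ (by simp [cfg])]
  · rw [← h2]
  · nlinarith

lemma p_l {w : ℝ} (hB : Big n w) (i) :
    power (gr S n) w (cfg U n g) (.l i) = 1 / 2 := by
  have h1 : (cnt (gr S n) (cfg U n g) .C (.l i) : ℝ) = 0 := by exact_mod_cast C_l S g i
  have h2 : (cnt (gr S n) (cfg U n g) .D (.l i) : ℝ) = 2 := by
    exact_mod_cast D_l S g i
  have h4 := hB.hw1
  rw [power_D_pos _ _ _ (by simp [cfg])]
  · rw [← h2]
  · nlinarith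

lemma inv_lt {a b : ℝ} (ha : 0 < a) (h : a < b) : 1 / b < 1 / a := one_div_lt_one_div_of_lt ha h

lemma cfg_y (i : ZMod n) : cfg U n g (.y i) = .C ↔ (i = g ∨ i = g + 1 ∨ i = g + 2) := by
  simp only [cfg, ite_C]

lemma cfg_x (b : Bool) (i : ZMod n) :
    cfg U n g (.x b i) = .C ↔ (i + 1 = g ∨ i = g ∨ i = g + 1) := by
  simp only [cfg, ite_C]

lemma ne_C {s : Strategy} : s ≠ .C ↔ s = .D := by cases s <;> simp

lemma ne_D {s : Strategy} : s ≠ .D ↔ s = .C := by cases s <;> simp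

lemma step_yC {w : ℝ} (hB : Big n w) (j : ZMod n) (hj : j = g + 1 ∨ j = g + 2 ∨ j = g + 3) :
    step (gr S n) w (cfg U n g) (.y j) = .C := by
  have h3 := hB.cast
  obtain ⟨h1, h2, h3, h4, h5, h6, h7, h8, h9, h10, h11, h12, h13⟩ := nzf hB.nz g
  apply step_strict (u := .y (g + 2))
  · rcases hj with rfl | rfl | rfl
    · right; simp only [gr, adj]
      exact ⟨h3.symm, Or.inl (by ring)⟩
    · left; rfl
    · right; simp only [gr, adj]
      refine ⟨fun h => h11 (by linear_combination -h), Or.inr (by ring)⟩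
  · simp [cfg]
  · rw [p_y2 S g hB]
    rintro (a | i | ⟨b, i⟩ | i | i | _ | i) hx hc
    · simp [gr, adj] at hx
    · rw [p_yD S g hB i (ne_C.1 hc)]; positivity
    · refine (p_xD S g hB b i (ne_C.1 hc)).trans_lt (inv_lt (by positivity) (by linarith))
    · simp [cfg] at hc
    · simp [gr, adj] at hx
    · rw [p_k S g hB]; exact inv_lt (by positivity) (by linarith)
    · simp [gr, adj] at hx

lemma step_yD {w : ℝ} (hB : Big n w) (j : ZMod n) (hj : ¬ (j = g + 1 ∨ j = g + 2 ∨ j = g + 3)) :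
    step (gr S n) w (cfg U n g) (.y j) = .D := by
  have h3 := hB.cast
  apply step_strict (u := .k)
  · right; simp [gr, adj]
  · simp [cfg]
  · rw [p_k S g hB]
    rintro (a | i | ⟨b, i⟩ | i | i | _ | i) hx hc
    · simp [gr, adj] at hx
    · rcases (cfg_y g i).1 (ne_D.1 hc) with rfl | rfl | rfl
      · rw [p_y0 S _ hB]; exact inv_lt (by positivity) (by linarith)
      · rw [p_y1 S _ hB]; exact inv_lt (by positivity) (by linarith)
      · exfalso
        push Not at hj
        rcases hx with hx | hx
        · simp at hx; exact hj.2.1 hx.symm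
        · simp only [gr, adj] at hx
          rcases hx.2 with h | h
          · exact hj.1 (by linear_combination -h)
          · exact hj.2.2 (by linear_combination h)
    · rw [p_xC S g hB b i (ne_D.1 hc)]; positivity
    · rw [p_q S g hB]; positivity
    · simp [gr, adj] at hx
    · simp [cfg] at hc
    · simp [gr, adj] at hx

lemma p_y_bounds {w : ℝ} (hB : Big n w) (i : ZMod n) (h : cfg U n g (.y i) = .C) :
    1 / ((n : ℝ) + 5) ≤ power (gr S n) w (cfg U n g) (.y i) ∧
    power (gr S n) w (cfg U n g) (.y i) ≤ 1 / 2 := by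
  have h3 := hB.cast
  rcases (cfg_y g i).1 h with rfl | rfl | rfl
  · rw [p_y0 S _ hB]
    exact ⟨one_div_le_one_div_of_le (by positivity) (by linarith),
      one_div_le_one_div_of_le (by positivity) (by linarith)⟩
  · rw [p_y1 S _ hB]
    exact ⟨le_rfl, one_div_le_one_div_of_le (by positivity) (by linarith)⟩
  · rw [p_y2 S _ hB]
    exact ⟨one_div_le_one_div_of_le (by positivity) (by linarith),
      one_div_le_one_div_of_le (by positivity) (by linarith)⟩

lemma step_xC {w : ℝ} (hB : Big n w) (b : Bool) (j : ZMod n)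
    (hj : j = g ∨ j = g + 1 ∨ j = g + 2) :
    step (gr S n) w (cfg U n g) (.x b j) = .C := by
  have h3 := hB.cast
  have hc := (cfg_y (U := U) g j).2 hj
  have hp := (p_y_bounds S g hB j hc).1
  apply step_strict (u := .y j)
  · right; simp [gr, adj]
  · exact hc
  · rintro (a | i | ⟨b, i⟩ | i | i | _ | i) hx hc
    · simp [gr, adj] at hx
    · simp [gr, adj] at hx; subst hx; contradiction
    · refine ((p_xD S g hB b i (ne_C.1 hc)).trans_lt
        (inv_lt (by positivity) (by linarith))).trans_le hp
    · simp [gr, adj] at hx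
    · rw [p_r S g hB]
      exact (inv_lt (by positivity) (by linarith)).trans_le hp
    · simp [gr, adj] at hx
    · simp [gr, adj] at hx

lemma step_xD {w : ℝ} (hB : Big n w) (b : Bool) (j : ZMod n)
    (hj : ¬ (j = g ∨ j = g + 1 ∨ j = g + 2)) :
    step (gr S n) w (cfg U n g) (.x b j) = .D := by
  have h3 := hB.cast
  have hn := hB.hn
  apply step_strict (u := .r ⟨0, by omega⟩)
  · right; simp [gr, adj]
  · simp [cfg]
  · rw [p_r S g hB]
    have hpos : 0 < 1 / (2 * (n : ℝ) - 5) := one_div_pos.2 (by linarith)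
    rintro (a | i | ⟨b, i⟩ | i | i | _ | i) hx hc
    · simp [gr, adj] at hx
    · simp [gr, adj] at hx; subst hx
      exact absurd ((cfg_y g i).1 (ne_D.1 hc)) hj
    · rw [p_xC S g hB b i (ne_D.1 hc)]; exact hpos
    · simp [gr, adj] at hx
    · simp [cfg] at hc
    · simp [gr, adj] at hx
    · simp [gr, adj] at hx

lemma step_q {w : ℝ} (hB : Big n w) (j) :
    step (gr S n) w (cfg U n g) (.q j) = .C := by
  apply step_weak (u := .q j)
  · simp [cfg]
  · left; rfl
  · simp [cfg]
  · rw [p_q S g hB]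
    rintro (a | i | ⟨b, i⟩ | i | i | _ | i) hx hc
    · simp [gr, adj] at hx
    · rw [p_yD S g hB i (ne_C.1 hc)]
    · simp [gr, adj] at hx
    · simp [cfg] at hc
    · simp [gr, adj] at hx
    · simp [gr, adj] at hx
    · simp [gr, adj] at hx

lemma step_r {w : ℝ} (hB : Big n w) (j) :
    step (gr S n) w (cfg U n g) (.r j) = .D := by
  have h3 := hB.cast
  apply step_weak (u := .r j)
  · simp [cfg]
  · left; rfl
  · simp [cfg]
  · rw [p_r S g hB]
    have hpos : 0 < 1 / (2 * (n : ℝ) - 5) := one_div_pos.2 (by linarith)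
    rintro (a | i | ⟨b, i⟩ | i | i | _ | i) hx hc
    · simp [gr, adj] at hx
    · simp [gr, adj] at hx
    · rw [p_xC S g hB b i (ne_D.1 hc)]; exact hpos.le
    · simp [gr, adj] at hx
    · simp [cfg] at hc
    · simp [gr, adj] at hx
    · simp [gr, adj] at hx

lemma step_k {w : ℝ} (hB : Big n w) :
    step (gr S n) w (cfg U n g) .k = .D := by
  apply step_weak (u := .l 0)
  · simp [cfg]
  · right; simp [gr, adj]
  · simp [cfg]
  · rw [p_l S g hB]
    rintro (a | i | ⟨b, i⟩ | i | i | _ | i) hx hc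
    · simp [gr, adj] at hx
    · exact (p_y_bounds S g hB i (ne_D.1 hc)).2
    · simp [gr, adj] at hx
    · simp [gr, adj] at hx
    · simp [cfg] at hc
    · simp [cfg] at hc
    · simp [cfg] at hc

lemma step_l {w : ℝ} (j) :
    step (gr S n) w (cfg U n g) (.l j) = .D := by
  apply step_weak (u := .l j)
  · simp [cfg]
  · left; rfl
  · simp [cfg]
  · rintro (a | i | ⟨b, i⟩ | i | i | _ | i) hx hc <;>
      first | simp [gr, adj] at hx; done | simp [cfg] at hc

lemma step_u {w : ℝ} (j) :
    step (gr S n) w (cfg U n g) (.u j) = .D := by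
  apply step_weak (u := .u j)
  · simp [cfg]
  · left; rfl
  · simp [cfg]
  · rintro (a | i | ⟨b, i⟩ | i | i | _ | i) hx hc <;>
      first | simp [cfg] at hc; done | simp [gr, adj] at hx

lemma step_cfg {w : ℝ} (hB : Big n w) :
    step (gr S n) w (cfg U n g) = cfg U n (g + 1) := by
  funext v
  rcases v with (a | i | ⟨b, i⟩ | i | i | _ | i)
  · rw [step_u]; rfl
  · have e2 : g + 1 + 1 = g + 2 := by ring
    have e3 : g + 1 + 2 = g + 3 := by ring
    by_cases hj : i = g + 1 ∨ i = g + 2 ∨ i = g + 3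
    · rw [step_yC S g hB i hj, eq_comm, cfg_y, e2, e3]; exact hj
    · rw [step_yD S g hB i hj, eq_comm, ← ne_C, Ne, cfg_y, e2, e3]; exact hj
  · have e2 : g + 1 + 1 = g + 2 := by ring
    by_cases hj : i = g ∨ i = g + 1 ∨ i = g + 2
    · rw [step_xC S g hB b i hj, eq_comm, cfg_x, e2, add_left_inj]; exact hj
    · rw [step_xD S g hB b i hj, eq_comm, ← ne_C, Ne, cfg_x, e2, add_left_inj]; exact hj
  · rw [step_q S g hB]; rfl
  · rw [step_r S g hB]; rfl
  · rw [step_k S g hB]; rfl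
  · rw [step_l]; rfl

lemma seq_cfg {w : ℝ} (hB : Big n w) (t : ℕ) :
    configSeq (gr S n) w (cfg U n 0) t = cfg U n (t : ZMod n) := by
  induction t with
  | zero => simp [configSeq]
  | succ t ih =>
    show step (gr S n) w (configSeq (gr S n) w (cfg U n 0) t) = _
    rw [ih, step_cfg S _ hB]; push_cast; rfl

lemma cfg_inj (hn : NZ n) (a b : ZMod n) (h : cfg U n a = cfg U n b) : a = b := by
  have key : ∀ i : ZMod n, (i = a ∨ i = a + 1 ∨ i = a + 2) ↔ (i = b ∨ i = b + 1 ∨ i = b + 2) := by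
    intro i
    rw [← cfg_y (U := U), ← cfg_y (U := U), h]
  obtain ⟨h1, h2, h3, h4⟩ := hn
  rcases (key a).1 (Or.inl rfl) with h | h | h
  · exact h
  · exfalso
    rcases (key b).2 (Or.inl rfl) with h' | h' | h'
    · exact h1 (by linear_combination -h' - h)
    · exact h2 (by linear_combination -h - h')
    · exact h3 (by linear_combination -h - h')
  · exfalso
    rcases (key b).2 (Or.inl rfl) with h' | h' | h'
    · exact h2 (by linear_combination -h' - h)
    · exact h3 (by linear_combination -h - h')
    · exact h4 (by linear_combination -h - h')

lemma periodic {w : ℝ} (hB : Big n w) :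
    EventuallyPeriodicWithPeriod (gr S n) w (cfg U n 0) n := by
  have hn := hB.hn
  constructor
  · refine ⟨by omega, 0, ?_⟩
    rw [seq_cfg S hB, seq_cfg S hB]; simp
  · rintro m ⟨hm, i, hi⟩
    rw [seq_cfg S hB, seq_cfg S hB] at hi
    have := cfg_inj hB.nz _ _ hi
    push_cast at this
    have h0 : (m : ZMod n) = 0 := by linear_combination this
    rw [ZMod.natCast_eq_zero_iff] at h0
    exact Nat.le_of_dvd (by omega) h0

end PIP

/-- For every win condition `w ∈ [1/2, 1)`, every positive integer
`k`, and every finite simple graph `S`, there exist a finite simple graph `G`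
containing `S` as an induced subgraph and an initial configuration on `G` from which
the `w`-power index process is eventually periodic with period at least `k`. -/
theorem statement15 (w : ℝ) (hw1 : 1 / 2 ≤ w) (hw2 : w < 1) (k : ℕ) (hk : 0 < k)
    {U : Type} [Fintype U] (S : SimpleGraph U) :
    ∃ (m : ℕ) (G : SimpleGraph (Fin m)) (_ : S ↪g G) (c0 : Fin m → Strategy) (ℓ : ℕ),
      k ≤ ℓ ∧ EventuallyPeriodicWithPeriod G w c0 ℓ := by
  obtain ⟨N, hN⟩ := exists_nat_gt (6 * w / (1 - w))
  obtain ⟨n, hn⟩ : ∃ n, n = N + k + 11 := ⟨_, rfl⟩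
  have : NeZero n := ⟨by omega⟩
  have hB : PIP.Big n w := by
    refine ⟨by omega, hw1, hw2, ?_⟩
    have hNn : (N : ℝ) ≤ n := by exact_mod_cast (by omega : N ≤ n)
    have h := hN.trans_le hNn
    rw [div_lt_iff₀ (by linarith)] at h
    nlinarith
  let e := Fintype.equivFin (PIP.Vt U n)
  let ι : (PIP.gr S n) ≃g ((PIP.gr S n).map e.toEmbedding) := SimpleGraph.Iso.map e _
  have hper := PIP.periodic S hB
  refine ⟨_, (PIP.gr S n).map e.toEmbedding, ?_, PIP.cfg U n 0 ∘ ι.symm, n, by omega, ?_⟩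
  · refine RelEmbedding.trans (⟨⟨PIP.Vt.u, fun a b h => by simpa using h⟩, ?_⟩ : S ↪g PIP.gr S n)
      ι.toRelEmbedding
    intro a b
    exact Iff.rfl
  · unfold EventuallyPeriodicWithPeriod at hper ⊢
    convert hper using 2
    ext m
    simp only [PIP.configSeq_iso _ _ ι.symm]
    refine and_congr_right fun _ => exists_congr fun i => ?_
    exact ι.symm.surjective.injective_comp_right.eq_iff
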